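/- Let ξ be a nonzero ordinal and S a finite set. For any function f : Λ^e(𝒯_ξ) → S, there exist a function g : Λ(𝒯_ξ) → S and an extended monotone map (θ₁,e₁) from 𝒯_ξ into 𝒯_ξ such that g(s,t) = f(θ₁(s), θ₁(t), e₁(v)) for all (s,t,v) ∈ Λ^e(𝒯_ξ). -/

import Mathlib

noncomputable section
open Ordinal

/-- `s` is a proper initial segment of `t`. -/
def SPrefix {S : Type*} (s t : List S) : Prop := s <+: t ∧ s ≠ t

/-- The maximal members of a tree of finite sequences: those with no proper extension. -/
def MaxNodes {S : Type*} (T : Set (List S)) : Set (List S) :=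
  { t ∈ T | ¬ ∃ u ∈ T, SPrefix t u }

/-- A B-tree: a set of nonempty finite sequences which, together with the empty
sequence, is downward closed under the initial segment order. -/
def IsBTree {S : Type*} (T : Set (List S)) : Prop :=
  [] ∉ T ∧ ∀ s t : List S, t ∈ T → s <+: t → s ≠ [] → s ∈ T

/-- The derived tree: members having a proper extension in `T`. -/
def treeDeriv {S : Type*} (T : Set (List S)) : Set (List S) :=
  { s ∈ T | ∃ t ∈ T, SPrefix s t }

/-- Transfinite iterates of the derivative. -/
def derivIter {S : Type*} (T : Set (List S)) (o : Ordinal.{0}) : Set (List S) :=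
  Ordinal.limitRecOn o T (fun _ ih => treeDeriv ih)
    (fun o _ ih => ⋂ p : {p : Ordinal.{0} // p < o}, ih p.1 p.2)

open scoped Classical in
/-- The order `o(T)`, with value `⊤ = ∞` for ill-founded trees. -/
def treeOrder {S : Type*} (T : Set (List S)) : WithTop Ordinal :=
  if _ : ∃ o : Ordinal.{0}, derivIter T o = ∅ then
    ↑(sInf {o : Ordinal.{0} | derivIter T o = ∅}) else ⊤

/-- A tree of finite sequences is well-founded if it has no infinite strictly
increasing chain. -/
def WellFoundedTree {S : Type*} (T : Set (List S)) : Prop :=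
  ¬ ∃ c : ℕ → List S, (∀ n, c n ∈ T) ∧ ∀ n, SPrefix (c n) (c (n + 1))

/-- A monotone map from (a tree) `T` into (a tree) `V`. -/
def MonotoneTreeMap {S₁ S₂ : Type*} (θ : List S₁ → List S₂)
    (T : Set (List S₁)) (V : Set (List S₂)) : Prop :=
  Set.MapsTo θ T V ∧ ∀ s ∈ T, ∀ t ∈ T, SPrefix s t → SPrefix (θ s) (θ t)

/-- An extended monotone map `(θ, e)` from `T` into `V`. -/
def ExtMonotoneTreeMap {S₁ S₂ : Type*} (θ e : List S₁ → List S₂)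
    (T : Set (List S₁)) (V : Set (List S₂)) : Prop :=
  MonotoneTreeMap θ T V ∧ Set.MapsTo e (MaxNodes T) (MaxNodes V) ∧
    ∀ s ∈ MaxNodes T, θ s <+: e s

/-- The B-trees `𝒯_ξ` on the ordinals: `𝒯_1 = {(1)}`,
`𝒯_{ξ+1} = {(ξ+1)} ∪ {(ξ+1)⌢t : t ∈ 𝒯_ξ}`, and `𝒯_ξ = ⋃_{η<ξ} 𝒯_{η+1}` at limits. -/
def calT : Ordinal.{0} → Set (List Ordinal.{0}) := fun ξ =>
  Ordinal.limitRecOn ξ ∅ (fun o ih => {[o + 1]} ∪ (List.cons (o + 1)) '' ih)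
    (fun o _ ih => ⋃ p : {p : Ordinal.{0} // p < o}, ih p.1 p.2)

/-- The tree product `[T₀, T₁]`: concatenations of blocks `(sᵢ, xᵢ^{(|sᵢ|)})` with
`sᵢ ∈ T₀`, all but the last `sᵢ` maximal in `T₀`, and `(xᵢ)ᵢ ∈ T₁`. -/
def treeProd {S₀ S₁ : Type*} (T₀ : Set (List S₀)) (T₁ : Set (List S₁)) :
    Set (List (S₀ × S₁)) :=
  { l | ∃ (k : ℕ) (s : Fin (k + 1) → List S₀) (x : Fin (k + 1) → S₁),
      (∀ i, s i ∈ T₀) ∧ (∀ i : Fin (k + 1), (i : ℕ) < k → s i ∈ MaxNodes T₀) ∧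
      List.ofFn x ∈ T₁ ∧
      l = (List.ofFn fun i => (s i).map fun a => (a, x i)).flatten }

/-- The member `l` of `[𝒯_{ω^ξ}, 𝒯_k]` lies on the `i`-th level, i.e. its unique block
decomposition has `i` blocks; equivalently its last second coordinate is `k - i + 1`. -/
def OnLevel (k i : ℕ) (l : List (Ordinal.{0} × Ordinal.{0})) : Prop :=
  ∃ p : Ordinal.{0} × Ordinal.{0}, l.getLast? = some p ∧ p.2 = ((k - i + 1 : ℕ) : Ordinal.{0})

/-- `U` is a unit of `[𝒯_{ω^ξ}, 𝒯_k]`: either the first level, or the set of proper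
extensions on level `i+1` of some `t` maximal in the `i`-th level. -/
def IsTPUnit (ξ : Ordinal.{0}) (k : ℕ) (U : Set (List (Ordinal.{0} × Ordinal.{0}))) : Prop :=
  U = {l ∈ treeProd (calT (omega0 ^ ξ)) (calT (k : ℕ)) | OnLevel k 1 l} ∨
  ∃ (t : List (Ordinal.{0} × Ordinal.{0})) (i : ℕ), 1 ≤ i ∧ i < k ∧
    t ∈ treeProd (calT (omega0 ^ ξ)) (calT (k : ℕ)) ∧ OnLevel k i t ∧
    (¬ ∃ u ∈ treeProd (calT (omega0 ^ ξ)) (calT (k : ℕ)), SPrefix t u ∧ OnLevel k i u) ∧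
    U = {l ∈ treeProd (calT (omega0 ^ ξ)) (calT (k : ℕ)) | SPrefix t l ∧ OnLevel k (i + 1) l}



lemma calT_zero : calT 0 = ∅ := by
  simp [calT]

lemma mem_calT_succ {η : Ordinal.{0}} {l : List Ordinal.{0}} :
    l ∈ calT (η + 1) ↔ ∃ t, l = (η + 1) :: t ∧ (t = [] ∨ t ∈ calT η) := by
  have h : calT (η + 1) = {[η + 1]} ∪ (List.cons (η + 1)) '' (calT η) := by
    unfold calT
    exact Ordinal.limitRecOn_add_one ..
  rw [h]
  constructor
  · rintro (h | ⟨t, ht, rfl⟩)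
    · exact ⟨[], h, Or.inl rfl⟩
    · exact ⟨t, rfl, Or.inr ht⟩
  · rintro ⟨t, rfl, rfl | ht⟩
    · exact Or.inl rfl
    · exact Or.inr ⟨t, ht, rfl⟩

lemma mem_calT_limit' {ξ : Ordinal.{0}} (hξ : Order.IsSuccLimit ξ) {l : List Ordinal.{0}} :
    l ∈ calT ξ ↔ ∃ p < ξ, l ∈ calT p := by
  have h : calT ξ = ⋃ p : {p : Ordinal.{0} // p < ξ}, calT p.1 := by
    unfold calT
    exact Ordinal.limitRecOn_limit _ _ _ _ hξ
  rw [h]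
  simp

lemma mem_calT_le {ξ : Ordinal.{0}} {l : List Ordinal.{0}} :
    l ∈ calT ξ → ∃ η < ξ, l ∈ calT (η + 1) := by
  induction ξ using Ordinal.limitRecOn with
  | zero => simp [calT_zero]
  | add_one η ih => exact fun h => ⟨η, by simp, h⟩
  | limit ξ hξ ih =>
    intro h
    obtain ⟨p, hp, h⟩ := (mem_calT_limit' hξ).1 h
    obtain ⟨η, hη, h⟩ := ih p hp h
    exact ⟨η, hη.trans hp, h⟩

lemma succ_lt_lim {ξ η : Ordinal.{0}} (hξ : Order.IsSuccLimit ξ) (h : η < ξ) : η + 1 < ξ := by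
  exact hξ.add_one_lt h

lemma mem_calT_limit {ξ : Ordinal.{0}} (hξ : Order.IsSuccLimit ξ) {l : List Ordinal.{0}} :
    l ∈ calT ξ ↔ ∃ η < ξ, l ∈ calT (η + 1) :=
  ⟨mem_calT_le, fun ⟨η, hη, h⟩ => (mem_calT_limit' hξ).2 ⟨η + 1, succ_lt_lim hξ hη, h⟩⟩

lemma sp_cons {a : Ordinal.{0}} {s t : List Ordinal.{0}} :
    SPrefix (a :: s) (a :: t) ↔ SPrefix s t := by
  simp [SPrefix, List.cons_prefix_cons]

lemma sp_nil {t : List Ordinal.{0}} : SPrefix [] t ↔ t ≠ [] := by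
  simp [SPrefix, eq_comm]

lemma nil_notMem (ξ : Ordinal.{0}) : [] ∉ calT ξ := by
  intro h
  obtain ⟨η, _, h⟩ := mem_calT_le h
  obtain ⟨t, h, _⟩ := mem_calT_succ.1 h
  simp at h

lemma ne_nil {ξ : Ordinal.{0}} {t : List Ordinal.{0}} (h : t ∈ calT ξ) : t ≠ [] := by
  rintro rfl; exact nil_notMem _ h

lemma sp_not_nil {t : List Ordinal.{0}} : ¬ SPrefix t [] := by
  rintro ⟨h, h2⟩
  exact h2 (List.prefix_nil.1 h)

lemma cons_max {η : Ordinal.{0}} {t : List Ordinal.{0}} (h : t ∈ MaxNodes (calT η)) :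
    (η + 1) :: t ∈ MaxNodes (calT (η + 1)) := by
  refine ⟨mem_calT_succ.2 ⟨t, rfl, Or.inr h.1⟩, ?_⟩
  rintro ⟨u, hu, hs⟩
  obtain ⟨w, rfl, rfl | hw⟩ := mem_calT_succ.1 hu
  · exact sp_not_nil (sp_cons.1 hs)
  · exact h.2 ⟨w, hw, sp_cons.1 hs⟩

lemma oneT_max : [(0 : Ordinal.{0}) + 1] ∈ MaxNodes (calT (0 + 1)) := by
  refine ⟨mem_calT_succ.2 ⟨[], rfl, Or.inl rfl⟩, ?_⟩
  rintro ⟨u, hu, hs⟩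
  obtain ⟨w, rfl, rfl | hw⟩ := mem_calT_succ.1 hu
  · exact sp_not_nil (sp_cons.1 hs)
  · simp [calT_zero] at hw

lemma max_lim {ξ η : Ordinal.{0}} (hξ : Order.IsSuccLimit ξ) (h : η < ξ) {v : List Ordinal.{0}}
    (hv : v ∈ MaxNodes (calT (η + 1))) : v ∈ MaxNodes (calT ξ) := by
  refine ⟨(mem_calT_limit hξ).2 ⟨η, h, hv.1⟩, ?_⟩
  rintro ⟨u, hu, hs⟩
  obtain ⟨η', hη', hu⟩ := (mem_calT_limit hξ).1 hu
  have hu' := hu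
  obtain ⟨w, rfl, hw⟩ := mem_calT_succ.1 hu
  obtain ⟨t, rfl, ht⟩ := mem_calT_succ.1 hv.1
  have := (List.cons_prefix_cons.1 hs.1).1
  rw [← this] at hu' hs
  exact hv.2 ⟨_, hu', hs⟩

lemma lim_max {ξ : Ordinal.{0}} (hξ : Order.IsSuccLimit ξ) {v : List Ordinal.{0}}
    (hv : v ∈ MaxNodes (calT ξ)) : ∃ η < ξ, v ∈ MaxNodes (calT (η + 1)) := by
  obtain ⟨η, hη, h⟩ := (mem_calT_limit hξ).1 hv.1
  exact ⟨η, hη, h, fun ⟨u, hu, hs⟩ => hv.2 ⟨u, (mem_calT_limit hξ).2 ⟨η, hη, hu⟩, hs⟩⟩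

lemma exists_max (ξ : Ordinal.{0}) (h : ξ ≠ 0) : ∃ v, v ∈ MaxNodes (calT ξ) := by
  induction ξ using Ordinal.limitRecOn with
  | zero => simp at h
  | add_one η ih =>
    by_cases h0 : η = 0
    · subst h0; exact ⟨_, oneT_max⟩
    · obtain ⟨v, hv⟩ := ih h0
      exact ⟨_, cons_max hv⟩
  | limit ξ hξ ih =>
    obtain ⟨v, hv⟩ := ih (0 + 1) (succ_lt_lim hξ (pos_iff_ne_zero.2 h)) (by simp)
    exact ⟨v, max_lim hξ (pos_iff_ne_zero.2 h) hv⟩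

/-- members of Max of successor -/
lemma max_succ {η : Ordinal.{0}} {v : List Ordinal.{0}} (hv : v ∈ MaxNodes (calT (η + 1))) :
    (η = 0 ∧ v = [η + 1]) ∨ ∃ t ∈ MaxNodes (calT η), v = (η + 1) :: t := by
  obtain ⟨t, rfl, rfl | ht⟩ := mem_calT_succ.1 hv.1
  · left
    refine ⟨?_, rfl⟩
    by_contra h0
    obtain ⟨w, hw⟩ := exists_max η h0
    exact hv.2 ⟨(η + 1) :: w, mem_calT_succ.2 ⟨w, rfl, Or.inr hw.1⟩,
      sp_cons.2 (sp_nil.2 (ne_nil hw.1))⟩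
  · right
    refine ⟨t, ⟨ht, ?_⟩, rfl⟩
    rintro ⟨u, hu, hs⟩
    exact hv.2 ⟨(η + 1) :: u, mem_calT_succ.2 ⟨u, rfl, Or.inr hu⟩, sp_cons.2 hs⟩

abbrev XMap (θ e : List Ordinal.{0} → List Ordinal.{0}) (ξ ζ : Ordinal.{0}) : Prop :=
  ExtMonotoneTreeMap θ e (calT ξ) (calT ζ)

lemma XMap.comp {θ e θ' e' : List Ordinal.{0} → List Ordinal.{0}} {ξ ζ ρ : Ordinal.{0}}
    (h : XMap θ e ζ ρ) (h' : XMap θ' e' ξ ζ) : XMap (fun l => θ (θ' l)) (fun l => e (e' l)) ξ ρ := by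
  obtain ⟨⟨a, b⟩, c, d⟩ := h
  obtain ⟨⟨a', b'⟩, c', d'⟩ := h'
  refine ⟨⟨fun l hl => a (a' hl), fun s hs t ht hst => b _ (a' hs) _ (a' ht) (b' s hs t ht hst)⟩,
    fun l hl => c (c' hl), fun s hs => ?_⟩
  refine List.IsPrefix.trans ?_ (d _ (c' hs))
  by_cases he : θ' s = e' s
  · simp only [he]; exact List.prefix_refl _
  · exact (b _ (a' hs.1) _ (c' hs).1 ⟨d' s hs, he⟩).1

lemma XMap.pre {θ e : List Ordinal.{0} → List Ordinal.{0}} {ξ ζ : Ordinal.{0}}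
    (h : XMap θ e ξ ζ) {t v : List Ordinal.{0}} (ht : t ∈ calT ξ) (hv : v ∈ MaxNodes (calT ξ))
    (htv : t <+: v) : θ t <+: e v := by
  refine List.IsPrefix.trans ?_ (h.2.2 v hv)
  by_cases he : t = v
  · rw [he]
  · exact (h.1.2 _ ht _ hv.1 ⟨htv, he⟩).1

lemma XMap.ident (ξ : Ordinal.{0}) : XMap id id ξ ξ :=
  ⟨⟨fun _ h => h, fun _ _ _ _ h => h⟩, fun _ h => h, fun _ _ => List.prefix_refl _⟩

lemma XMap.zero (θ e : List Ordinal.{0} → List Ordinal.{0}) (ζ : Ordinal.{0}) : XMap θ e 0 ζ := by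
  simp [XMap, ExtMonotoneTreeMap, MonotoneTreeMap, calT_zero, MaxNodes, Set.MapsTo]

lemma XMap.incl {θ e : List Ordinal.{0} → List Ordinal.{0}} {ξ ζ η : Ordinal.{0}}
    (hζ : Order.IsSuccLimit ζ) (hη : η < ζ) (h : XMap θ e ξ (η + 1)) : XMap θ e ξ ζ :=
  ⟨⟨fun _ hl => (mem_calT_limit hζ).2 ⟨η, hη, h.1.1 hl⟩, h.1.2⟩,
    fun _ hl => max_lim hζ hη (h.2.1 hl), h.2.2⟩

open scoped Classical in
def upMap (ζ : Ordinal.{0}) (θ : List Ordinal.{0} → List Ordinal.{0}) (l : List Ordinal.{0}) :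
    List Ordinal.{0} :=
  (ζ + 1) :: (if l.tail = [] then [] else θ l.tail)

lemma up_nil (ζ a θ) : upMap ζ θ [a] = [ζ + 1] := by simp [upMap]
lemma up_cons {ξ : Ordinal.{0}} (ζ a θ) {t} (h : t ∈ calT ξ) :
    upMap ζ θ (a :: t) = (ζ + 1) :: θ t := by simp [upMap, ne_nil h]

lemma XMap.up {θ e : List Ordinal.{0} → List Ordinal.{0}} {ξ ζ : Ordinal.{0}}
    (h : XMap θ e ξ ζ) (h0 : ξ = 0 → ζ = 0) : XMap (upMap ζ θ) (upMap ζ e) (ξ + 1) (ζ + 1) := by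
  refine ⟨⟨?_, ?_⟩, ?_, ?_⟩
  · intro l hl
    obtain ⟨t, rfl, rfl | ht⟩ := mem_calT_succ.1 hl
    · rw [up_nil]; exact mem_calT_succ.2 ⟨[], rfl, Or.inl rfl⟩
    · rw [up_cons _ _ _ ht]; exact mem_calT_succ.2 ⟨_, rfl, Or.inr (h.1.1 ht)⟩
  · intro s hs t ht hst
    replace hs := mem_calT_succ.1 hs
    replace ht := mem_calT_succ.1 ht
    obtain ⟨s, rfl, hs⟩ := hs
    obtain ⟨t, rfl, ht⟩ := ht
    rw [sp_cons] at hst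
    rcases ht with rfl | ht
    · exact (sp_not_nil hst).elim
    rw [up_cons _ _ _ ht]
    rcases hs with rfl | hs
    · rw [up_nil, sp_cons, sp_nil]
      exact ne_nil (h.1.1 ht)
    · rw [up_cons _ _ _ hs, sp_cons]
      exact h.1.2 _ hs _ ht hst
  · intro v hv
    rcases max_succ hv with ⟨rfl, rfl⟩ | ⟨t, ht, rfl⟩
    · rw [h0 rfl, up_nil]; exact oneT_max
    · rw [up_cons _ _ _ ht.1]; exact cons_max (h.2.1 ht)
  · intro v hv
    rcases max_succ hv with ⟨rfl, rfl⟩ | ⟨t, ht, rfl⟩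
    · rw [up_nil, up_nil]
    · rw [up_cons _ _ _ ht.1, up_cons _ _ _ ht.1, List.cons_prefix_cons]
      exact ⟨rfl, h.2.2 _ ht⟩

def predO (a : Ordinal.{0}) : Ordinal.{0} := sInf {η | a = η + 1}

lemma predO_add_one (η : Ordinal.{0}) : predO (η + 1) = η := by
  have : {x : Ordinal.{0} | η + 1 = x + 1} = {η} := by
    ext x
    simp [eq_comm]
  rw [predO, this, csInf_singleton]

def glue (Θ : Ordinal.{0} → List Ordinal.{0} → List Ordinal.{0}) (l : List Ordinal.{0}) :
    List Ordinal.{0} := Θ (predO l.headI) l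

lemma pred_head {η : Ordinal.{0}} {l} (h : l ∈ calT (η + 1)) : predO l.headI = η := by
  obtain ⟨t, rfl, _⟩ := mem_calT_succ.1 h
  exact predO_add_one η

lemma glue_eq {η : Ordinal.{0}} {l} (Θ) (h : l ∈ calT (η + 1)) : glue Θ l = Θ η l := by
  rw [glue, pred_head h]

lemma same_head {η η' : Ordinal.{0}} {s t} (hs : s ∈ calT (η + 1)) (ht : t ∈ calT (η' + 1))
    (h : s <+: t) : η = η' := by
  have h1 := pred_head hs
  have h2 := pred_head ht
  obtain ⟨s, rfl, _⟩ := mem_calT_succ.1 hs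
  obtain ⟨t, rfl, _⟩ := mem_calT_succ.1 ht
  have := (List.cons_prefix_cons.1 h).1
  simpa using this

lemma XMap.glue {Θ E : Ordinal.{0} → List Ordinal.{0} → List Ordinal.{0}} {ξ ζ : Ordinal.{0}}
    (hξ : Order.IsSuccLimit ξ)
    (h : ∀ η < ξ, XMap (Θ η) (E η) (η + 1) ζ) : XMap (glue Θ) (glue E) ξ ζ := by
  refine ⟨⟨?_, ?_⟩, ?_, ?_⟩
  · intro l hl
    obtain ⟨η, hη, hl⟩ := (mem_calT_limit hξ).1 hl
    rw [glue_eq _ hl]; exact (h η hη).1.1 hl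
  · intro s hs t ht hst
    obtain ⟨η, hη, hs⟩ := (mem_calT_limit hξ).1 hs
    obtain ⟨η', hη', ht⟩ := (mem_calT_limit hξ).1 ht
    obtain rfl := same_head hs ht hst.1
    rw [glue_eq _ hs, glue_eq _ ht]
    exact (h η hη).1.2 _ hs _ ht hst
  · intro l hl
    obtain ⟨η, hη, hl⟩ := lim_max hξ hl
    rw [glue_eq _ hl.1]; exact (h η hη).2.1 hl
  · intro l hl
    obtain ⟨η, hη, hl⟩ := lim_max hξ hl
    rw [glue_eq _ hl.1, glue_eq _ hl.1]; exact (h η hη).2.2 _ hl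

lemma lemC (ξ : Ordinal.{0}) : ∀ ζ, ξ ≤ ζ → ∃ θ e, XMap θ e ξ ζ := by
  induction ξ using Ordinal.limitRecOn with
  | zero => exact fun ζ _ => ⟨id, id, XMap.zero _ _ _⟩
  | add_one η ih =>
    intro ζ hζ
    change η + 1 ≤ ζ at hζ
    by_cases h0 : η = 0
    · subst h0
      have hz : ζ ≠ 0 := by
        rintro rfl
        simp at hζ
      obtain ⟨v, hv⟩ := exists_max ζ hz
      have key : ∀ t, t ∈ calT (0 + 1) → t = [0 + 1] := by
        intro t ht
        obtain ⟨t, rfl, rfl | ht⟩ := mem_calT_succ.1 ht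
        · rfl
        · simp [calT_zero] at ht
      refine ⟨fun _ => v, fun _ => v, ⟨fun _ _ => hv.1, ?_⟩, fun _ _ => hv,
        fun _ _ => List.prefix_refl _⟩
      intro s hs t ht hst
      exact (hst.2 ((key s hs).trans (key t ht).symm)).elim
    · induction ζ using Ordinal.limitRecOn with
      | zero => simp at hζ
      | add_one ζ _ =>
        obtain ⟨θ, e, h⟩ := ih ζ (by simpa using hζ)
        exact ⟨_, _, h.up (fun h => (h0 h).elim)⟩
      | limit ζ hl _ =>
        exact ⟨id, id, XMap.incl hl (lt_of_lt_of_le (by simp) hζ) (XMap.ident _)⟩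
  | limit ξ hξ ih =>
    intro ζ hζ
    have : ∀ η, ∃ θ e, η < ξ → XMap θ e (η + 1) ζ := by
      intro η
      by_cases hη : η < ξ
      · obtain ⟨θ, e, h⟩ := ih (η + 1) (succ_lt_lim hξ hη) ζ
          ((succ_lt_lim hξ hη).le.trans hζ)
        exact ⟨θ, e, fun _ => h⟩
      · exact ⟨id, id, fun h => (hη h).elim⟩
    choose Θ E h using this
    exact ⟨_, _, XMap.glue hξ h⟩

lemma lemB {C : Type*} [Finite C] (ξ : Ordinal.{0}) : ∀ c : List Ordinal.{0} → C,
    ∃ k θ e, XMap θ e ξ ξ ∧ ∀ v ∈ MaxNodes (calT ξ), c (e v) = k := by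
  induction ξ using Ordinal.limitRecOn with
  | zero =>
    intro c
    exact ⟨c [], id, id, XMap.zero _ _ _, fun v hv => by simp [calT_zero, MaxNodes] at hv⟩
  | add_one η ih =>
    intro c
    change ∃ k θ e, XMap θ e (η + 1) (η + 1) ∧ ∀ v ∈ MaxNodes (calT (η + 1)), c (e v) = k
    by_cases h0 : η = 0
    · subst h0
      refine ⟨c [0 + 1], id, id, XMap.ident _, fun v hv => ?_⟩
      rcases max_succ hv with ⟨_, rfl⟩ | ⟨t, ht, rfl⟩
      · rfl
      · simp [calT_zero, MaxNodes] at ht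
    obtain ⟨k, θ, e, h, hk⟩ := ih (fun l => c ((η + 1) :: l))
    refine ⟨k, _, _, h.up id, fun v hv => ?_⟩
    rcases max_succ hv with ⟨h, rfl⟩ | ⟨t, ht, rfl⟩
    · exact (h0 h).elim
    · rw [up_cons _ _ _ ht.1]; exact hk t ht
  | limit ξ hξ ih =>
    intro c
    have : ∀ η : Set.Iio ξ, ∃ k θ e, XMap θ e (η.1 + 1) (η.1 + 1) ∧
        ∀ v ∈ MaxNodes (calT (η.1 + 1)), c (e v) = k :=
      fun η => ih (η.1 + 1) (succ_lt_lim hξ η.2) c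
    choose K Θ E h hK using this
    have hne : Nonempty (Set.Iio ξ) := ⟨⟨0, hξ.bot_lt⟩⟩
    have pig : ∃ k, ∀ η : Set.Iio ξ, ∃ η', η ≤ η' ∧ K η' = k := by
      by_contra! hc
      choose m hm using hc
      obtain ⟨M, hM⟩ := Finite.exists_le m
      exact hm (K M) M (hM _) rfl
    obtain ⟨k, hk⟩ := pig
    have : ∀ η, ∃ θ e, η < ξ → XMap θ e (η + 1) ξ ∧
        ∀ v ∈ MaxNodes (calT (η + 1)), c (e v) = k := by
      intro η
      by_cases hη : η < ξ
      · obtain ⟨η', hle, hk'⟩ := hk ⟨η, hη⟩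
        have hle' : η ≤ η'.1 := hle
        obtain ⟨θ, e, h1⟩ := lemC (η + 1) (η'.1 + 1) (by gcongr)
        refine ⟨_, _, fun _ => ⟨XMap.incl hξ η'.2 ((h η').comp h1), fun v hv => ?_⟩⟩
        rw [← hk']
        exact hK _ _ (h1.2.1 hv)
      · exact ⟨id, id, fun h => (hη h).elim⟩
    choose Θ' E' h' using this
    refine ⟨k, _, _, XMap.glue hξ (fun η hη => (h' η hη).1), fun v hv => ?_⟩
    obtain ⟨η, hη, hv⟩ := lim_max hξ hv
    rw [glue_eq _ hv.1]
    exact (h' η hη).2 v hv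

lemma lemA {C : Type*} [Finite C] (ξ : Ordinal.{0}) :
    ∀ h : List Ordinal.{0} → List Ordinal.{0} → C,
    ∃ (g : List Ordinal.{0} → C) (θ e : _), XMap θ e ξ ξ ∧
      ∀ t ∈ calT ξ, ∀ v ∈ MaxNodes (calT ξ), t <+: v → h (θ t) (e v) = g t := by
  induction ξ using Ordinal.limitRecOn with
  | zero =>
    intro c
    exact ⟨fun t => c t t, id, id, XMap.zero _ _ _, fun v hv => by simp [calT_zero] at hv⟩
  | add_one η ih =>
    intro c
    change ∃ (g : List Ordinal.{0} → C) (θ e : _), XMap θ e (η + 1) (η + 1) ∧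
      ∀ t ∈ calT (η + 1), ∀ v ∈ MaxNodes (calT (η + 1)), t <+: v → c (θ t) (e v) = g t
    by_cases h0 : η = 0
    · subst h0
      refine ⟨fun t => c t [0 + 1], id, id, XMap.ident _, fun t ht v hv htv => ?_⟩
      rcases max_succ hv with ⟨_, rfl⟩ | ⟨t, ht, rfl⟩
      · rfl
      · simp [calT_zero, MaxNodes] at ht
    obtain ⟨k, θ, e, h, hk⟩ := lemB η (fun l => c [η + 1] ((η + 1) :: l))
    obtain ⟨g, θ', e', h', hg⟩ := ih (fun t v => c ((η + 1) :: θ t) ((η + 1) :: e v))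
    classical
    refine ⟨fun l => if l.tail = [] then k else g l.tail, _, _, (h.comp h').up id,
      fun t ht v hv htv => ?_⟩
    replace hv := max_succ hv
    rcases hv with ⟨h, rfl⟩ | ⟨v, hv, rfl⟩
    · exact (h0 h).elim
    rw [up_cons _ _ _ hv.1]
    replace ht := mem_calT_succ.1 ht
    obtain ⟨t, rfl, rfl | ht⟩ := ht
    · rw [up_nil]
      simpa using hk _ (h'.2.1 hv)
    · rw [up_cons _ _ _ ht]
      simpa [ne_nil ht] using hg t ht v hv (List.cons_prefix_cons.1 htv).2
  | limit ξ hξ ih =>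
    intro c
    have : ∀ η, ∃ (g : List Ordinal.{0} → C) (θ e : _), η < ξ → XMap θ e (η + 1) (η + 1) ∧
      ∀ t ∈ calT (η + 1), ∀ v ∈ MaxNodes (calT (η + 1)), t <+: v → c (θ t) (e v) = g t := by
      intro η
      by_cases hη : η < ξ
      · obtain ⟨g, θ, e, h⟩ := ih (η + 1) (succ_lt_lim hξ hη) c
        exact ⟨g, θ, e, fun _ => h⟩
      · exact ⟨fun _ => c [] [], id, id, fun h => (hη h).elim⟩
    choose G Θ E h using this
    refine ⟨fun l => G (predO l.headI) l, _, _,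
      XMap.glue hξ (fun η hη => XMap.incl hξ hη (h η hη).1), fun t ht v hv htv => ?_⟩
    obtain ⟨η, hη, hv⟩ := lim_max hξ hv
    obtain ⟨η', hη', ht⟩ := (mem_calT_limit hξ).1 ht
    obtain rfl := same_head ht hv.1 htv
    rw [glue_eq _ hv.1, glue_eq _ ht]
    simp only [pred_head ht]
    exact (h _ hη).2 t ht v hv htv

lemma lemMain {C : Type*} [Finite C] (ξ : Ordinal.{0}) :
    ∀ f : List Ordinal.{0} → List Ordinal.{0} → List Ordinal.{0} → C,
    ∃ (g : List Ordinal.{0} → List Ordinal.{0} → C)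
      (θ₁ e₁ : List Ordinal.{0} → List Ordinal.{0}),
      XMap θ₁ e₁ ξ ξ ∧
      ∀ s t v, s ∈ calT ξ → t ∈ calT ξ → v ∈ MaxNodes (calT ξ) →
        SPrefix s t → t <+: v → g s t = f (θ₁ s) (θ₁ t) (e₁ v) := by
  induction ξ using Ordinal.limitRecOn with
  | zero =>
    intro c
    exact ⟨fun s t => c s t t, id, id, XMap.zero _ _ _, fun s t v hs => by simp [calT_zero] at hs⟩
  | add_one η ih =>
    intro c
    change ∃ (g : List Ordinal.{0} → List Ordinal.{0} → C)
      (θ₁ e₁ : List Ordinal.{0} → List Ordinal.{0}),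
      XMap θ₁ e₁ (η + 1) (η + 1) ∧
      ∀ s t v, s ∈ calT (η + 1) → t ∈ calT (η + 1) → v ∈ MaxNodes (calT (η + 1)) →
        SPrefix s t → t <+: v → g s t = c (θ₁ s) (θ₁ t) (e₁ v)
    obtain ⟨g, θ, e, h, hg⟩ := lemA η (fun t v => c [η + 1] ((η + 1) :: t) ((η + 1) :: v))
    obtain ⟨g', θ', e', h', hg'⟩ := ih
      (fun s t v => c ((η + 1) :: θ s) ((η + 1) :: θ t) ((η + 1) :: e v))
    classical
    refine ⟨fun s t => if s.tail = [] then g (θ' t.tail) else g' s.tail t.tail, _, _,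
      (h.comp h').up id, fun s t v hs ht hv hst htv => ?_⟩
    replace hs := mem_calT_succ.1 hs
    replace ht := mem_calT_succ.1 ht
    obtain ⟨s, rfl, hs⟩ := hs
    obtain ⟨t, rfl, ht⟩ := ht
    rw [sp_cons] at hst
    rcases ht with rfl | ht
    · exact (sp_not_nil hst).elim
    replace hv := max_succ hv
    rcases hv with ⟨rfl, _⟩ | ⟨v, hv, rfl⟩
    · simp [calT_zero] at ht
    have htv := (List.cons_prefix_cons.1 htv).2
    rw [up_cons _ _ _ hv.1, up_cons _ _ _ ht]
    rcases hs with rfl | hs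
    · rw [up_nil]
      simpa using (hg _ (h'.1.1 ht) _ (h'.2.1 hv) (h'.pre ht hv htv)).symm
    · rw [up_cons _ _ _ hs]
      simpa [ne_nil hs] using hg' s t v hs ht hv hst htv
  | limit ξ hξ ih =>
    intro c
    have : ∀ η, ∃ (g : List Ordinal.{0} → List Ordinal.{0} → C)
      (θ₁ e₁ : List Ordinal.{0} → List Ordinal.{0}), η < ξ →
      XMap θ₁ e₁ (η + 1) (η + 1) ∧
      ∀ s t v, s ∈ calT (η + 1) → t ∈ calT (η + 1) → v ∈ MaxNodes (calT (η + 1)) →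
        SPrefix s t → t <+: v → g s t = c (θ₁ s) (θ₁ t) (e₁ v) := by
      intro η
      by_cases hη : η < ξ
      · obtain ⟨g, θ, e, h⟩ := ih (η + 1) (succ_lt_lim hξ hη) c
        exact ⟨g, θ, e, fun _ => h⟩
      · exact ⟨fun _ _ => c [] [] [], id, id, fun h => (hη h).elim⟩
    choose G Θ E h using this
    refine ⟨fun s t => G (predO t.headI) s t, _, _,
      XMap.glue hξ (fun η hη => XMap.incl hξ hη (h η hη).1), fun s t v hs ht hv hst htv => ?_⟩
    obtain ⟨η, hη, hv⟩ := lim_max hξ hv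
    obtain ⟨η', hη', ht⟩ := (mem_calT_limit hξ).1 ht
    obtain rfl := same_head ht hv.1 htv
    obtain ⟨η', hη', hs⟩ := (mem_calT_limit hξ).1 hs
    obtain rfl := same_head hs ht hst.1
    rw [glue_eq _ hv.1, glue_eq _ ht, glue_eq _ hs]
    simp only [pred_head ht]
    exact (h _ hη).2 s t v hs ht hv hst htv

/-- for any coloring `f : Λ^e(𝒯_ξ) → S` by a finite set, there are
`g : Λ(𝒯_ξ) → S` and an extended monotone map `(θ₁,e₁)` of `𝒯_ξ` into itself with
`g(s,t) = f(θ₁(s), θ₁(t), e₁(v))` for all `(s,t,v) ∈ Λ^e(𝒯_ξ)`. -/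
theorem statement17 {C : Type*} [Finite C] (ξ : Ordinal.{0}) (hξ : ξ ≠ 0)
    (f : List Ordinal.{0} → List Ordinal.{0} → List Ordinal.{0} → C) :
    ∃ (g : List Ordinal.{0} → List Ordinal.{0} → C)
      (θ₁ e₁ : List Ordinal.{0} → List Ordinal.{0}),
      ExtMonotoneTreeMap θ₁ e₁ (calT ξ) (calT ξ) ∧
      ∀ s t v, s ∈ calT ξ → t ∈ calT ξ → v ∈ MaxNodes (calT ξ) →
        SPrefix s t → t <+: v → g s t = f (θ₁ s) (θ₁ t) (e₁ v) := by
  exact lemMain ξ f
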